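/- Let q ≥ 1, α = (α_1,…,α_q) with each α_i a positive rational number, and β = (β_1,…,β_q) ∈ ℂ^q with Re(β_i) > 0 for all i. Write α_i = m_i/n_i in lowest terms, let L = lcm(n_1,…,n_q), k_i = α_i·L (a positive integer), and d_F = 2∑_{i=1}^q α_i. Set C₁ = L·d_F / (2·(∏_{i=1}^q k_i^{k_i})^{2/(L·d_F)}), C₂ = 2/d_F, and C₃ = ∑_{i=1}^q conj(β_i) + (1−q)/2. Then there exist constants C > 0 and x₀ > 0 such that for all x ≥ x₀, |Z̃_{α,β}(x)| ≤ C · exp(−C₁ · x^{C₂}) · x^{C₂·Re(C₃)}. -/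

import Mathlib

open Complex MeasureTheory Filter Topology Finset

noncomputable section

/-- The vertical line integral `(1/(2πi)) ∫_{Re s = c} (∏ i, Γ(αᵢ s + Bᵢ)) x^{-s} ds`,
parametrized by `s = c + it`. -/
def VI {q : ℕ} (α : Fin q → ℝ) (B : Fin q → ℂ) (c : ℝ) (x : ℝ) : ℂ :=
  (2 * (Real.pi : ℂ) * Complex.I)⁻¹ *
    ∫ t : ℝ, Complex.I *
      ((∏ i, Complex.Gamma ((α i : ℂ) * ((c : ℂ) + (t : ℂ) * Complex.I) + B i)) *
        (x : ℂ) ^ (-((c : ℂ) + (t : ℂ) * Complex.I)))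

/-- The abscissa `c_F`: `min_i 1/(2αᵢ)` if all `Re βᵢ = 0`, and `min_i Re βᵢ/αᵢ` otherwise. -/
def cFval {q : ℕ} (α : Fin q → ℝ) (β : Fin q → ℂ) : ℝ :=
  if ∀ i, (β i).re = 0 then ⨅ i, 1 / (2 * α i) else ⨅ i, (β i).re / α i

/-- Axioms (i)–(iv) of the Selberg class for `F` with Dirichlet coefficients `a` and
data `(Q, α, β, ω)`. -/
def SelbergAxioms (F : ℂ → ℂ) (a : ℕ → ℂ) (Q : ℝ) {q : ℕ} (α : Fin q → ℝ)
    (β : Fin q → ℂ) (ω : ℂ) : Prop :=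
  1 ≤ q ∧ 0 < Q ∧ (∀ i, 0 < α i) ∧ (∀ i, 0 ≤ (β i).re) ∧ ‖ω‖ = 1 ∧
  -- (i) Dirichlet series, absolutely convergent for Re s > 1, with a(1) = 1
  a 1 = 1 ∧
  (∀ s : ℂ, 1 < s.re →
    Summable (fun n : ℕ => ‖a (n + 1) / ((n : ℂ) + 1) ^ s‖) ∧
    HasSum (fun n : ℕ => a (n + 1) / ((n : ℂ) + 1) ^ s) (F s)) ∧
  -- (ii) analytic continuation: (s-1)^m F(s) extends to an entire function of finite order
  (∃ (m : ℕ) (G : ℂ → ℂ) (C r : ℝ), Differentiable ℂ G ∧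
    (∀ s, ‖G s‖ ≤ C * Real.exp (‖s‖ ^ r)) ∧ ∀ s, s ≠ 1 → G s = (s - 1) ^ m * F s) ∧
  -- (iii) functional equation Φ(s) = ω conj(Φ(1 - conj s))
  (∀ s : ℂ, (Q : ℂ) ^ s * F s * ∏ i, Complex.Gamma ((α i : ℂ) * s + β i) =
    ω * (starRingEnd ℂ) ((Q : ℂ) ^ (1 - (starRingEnd ℂ) s) * F (1 - (starRingEnd ℂ) s) *
      ∏ i, Complex.Gamma ((α i : ℂ) * (1 - (starRingEnd ℂ) s) + β i))) ∧
  -- (iv) Euler product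
  (∃ (g : ℕ → ℂ) (C₀ θ : ℝ), θ < 1 / 2 ∧
    (∀ p k : ℕ, p.Prime → 1 ≤ k → ‖g (p ^ k)‖ ≤ C₀ * (p : ℝ) ^ ((k : ℝ) * θ)) ∧
    (∀ s : ℂ, 1 < s.re → HasProd
      (fun p : Nat.Primes =>
        Complex.exp (∑' j : ℕ, g ((p : ℕ) ^ (j + 1)) / ((p : ℕ) : ℂ) ^ (((j : ℂ) + 1) * s)))
      (F s)))

/-- The extra axioms of the class `S*`: rational `αᵢ`, a polynomial Euler product, and
the Ramanujan hypothesis. -/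
def SStarAxioms (F : ℂ → ℂ) (a : ℕ → ℂ) {q : ℕ} (α : Fin q → ℝ) : Prop :=
  (∀ i, ∃ r : ℚ, α i = (r : ℝ)) ∧
  (∃ (N : ℕ) (γ : Nat.Primes → Fin N → ℂ), ∀ s : ℂ, 1 < s.re →
    HasProd (fun p : Nat.Primes => ∏ i, (1 - γ p i / ((p : ℕ) : ℂ) ^ s)⁻¹) (F s)) ∧
  (∀ ε : ℝ, 0 < ε → ∃ C : ℝ, ∀ n : ℕ, 1 ≤ n → ‖a n‖ ≤ C * (n : ℝ) ^ ε)

theorem norm_Gamma_le_Gamma_re {s : ℂ} (hs : 0 < s.re) : ‖Gamma s‖ ≤ Real.Gamma s.re := by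
  rw [Gamma_eq_integral hs, Real.Gamma_eq_integral hs, GammaIntegral]
  refine norm_integral_le_of_norm_le (Real.GammaIntegral_convergent hs) ?_
  refine (ae_restrict_iff' measurableSet_Ioi).mpr (Eventually.of_forall fun x hx => ?_)
  rw [norm_mul, norm_cpow_eq_rpow_re_of_pos hx, Complex.norm_of_nonneg (Real.exp_pos _).le]
  simp

/-- Iterating the recurrence `Γ(s + 1) = s Γ(s)` before comparing with `Γ(Re s)`. -/
theorem norm_Gamma_sq_mul_prod_le {s : ℂ} (hs : 0 < s.re) (N : ℕ) :
    ‖Gamma s‖ ^ 2 * ∏ n ∈ range N, (1 + s.im ^ 2 / (s.re + n) ^ 2) ≤ Real.Gamma s.re ^ 2 := by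
  induction N generalizing s with
  | zero =>
    simpa using pow_le_pow_left₀ (norm_nonneg _) (norm_Gamma_le_Gamma_re hs) 2
  | succ N ih =>
    have hs0 : s ≠ 0 := by
      rintro rfl
      simp at hs
    have h := @ih (s + 1) (by simpa using by linarith)
    have e1 : ‖Gamma (s + 1)‖ ^ 2 = (s.re ^ 2 + s.im ^ 2) * ‖Gamma s‖ ^ 2 := by
      rw [Gamma_add_one s hs0, norm_mul, mul_pow, ← normSq_eq_norm_sq s, normSq_apply]
      ring
    simp only [add_re, one_re, add_im, one_im, add_zero] at h
    rw [e1, Real.Gamma_add_one hs.ne', mul_pow] at h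
    rw [prod_range_succ']
    have e2 : ∀ n : ℕ, s.re + ((n + 1 : ℕ) : ℝ) = s.re + 1 + n := fun n => by push_cast; ring
    simp only [e2]
    have hp : 0 < s.re ^ 2 := by positivity
    refine le_of_mul_le_mul_left (le_trans (le_of_eq ?_) h) hp
    simp only [Nat.cast_zero, add_zero]
    field_simp

/-- Gaussian-scale decay of `Γ` along vertical lines, in a rational form that is integrable. -/
theorem norm_Gamma_le_Gamma_re_mul_inv {s : ℂ} (hs : 1 ≤ s.re) :
    ‖Gamma s‖ ≤ Real.Gamma s.re * (1 + (s.im / (5 * √s.re)) ^ 2)⁻¹ := by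
  have hs0 : 0 < s.re := by linarith
  set M := ⌈s.re⌉₊
  have hM1 : s.re ≤ M := Nat.le_ceil _
  have hM2 : (M : ℝ) < s.re + 1 := Nat.ceil_lt_add_one hs0.le
  have h := norm_Gamma_sq_mul_prod_le hs0 (2 * M)
  have hlow : (1 + (s.im / (5 * √s.re)) ^ 2) ^ 2 ≤
      ∏ n ∈ range (2 * M), (1 + s.im ^ 2 / (s.re + n) ^ 2) := by
    calc (1 + (s.im / (5 * √s.re)) ^ 2) ^ 2
        ≤ (1 + M * (s.im ^ 2 / (5 * s.re) ^ 2)) ^ 2 := by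
          have : (s.im / (5 * √s.re)) ^ 2 = s.re * (s.im ^ 2 / (5 * s.re) ^ 2) := by
            rw [div_pow, mul_pow, Real.sq_sqrt hs0.le]
            field_simp
          rw [this]
          gcongr
      _ ≤ ((1 + s.im ^ 2 / (5 * s.re) ^ 2) ^ M) ^ 2 := by
          gcongr
          refine one_add_mul_le_pow (le_trans (by norm_num : (-2 : ℝ) ≤ 0) ?_) M
          positivity
      _ = ∏ _n ∈ range (2 * M), (1 + s.im ^ 2 / (5 * s.re) ^ 2) := by
          rw [prod_const, card_range, ← pow_mul, mul_comm M]
      _ ≤ _ := by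
          refine prod_le_prod (fun _ _ => by positivity) fun n hn => ?_
          have hn' : (n : ℝ) < 2 * M := by exact_mod_cast mem_range.mp hn
          gcongr
          linarith
  rw [← div_eq_mul_inv, le_div_iff₀ (by positivity)]
  refine le_of_sq_le_sq ?_ (Real.Gamma_pos_of_pos hs0).le
  rw [mul_pow]
  exact (mul_le_mul_of_nonneg_left hlow (by positivity)).trans h

theorem Real.factorial_le_stirling {n : ℕ} (hn : n ≠ 0) :
    (n.factorial : ℝ) ≤ Real.exp 1 * √n * (n / Real.exp 1) ^ n := by
  obtain ⟨m, rfl⟩ := Nat.exists_eq_succ_of_ne_zero hn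
  have h : Stirling.stirlingSeq (m + 1) ≤ Stirling.stirlingSeq 1 :=
    Stirling.stirlingSeq'_antitone (Nat.zero_le m)
  rw [Stirling.stirlingSeq_one, Stirling.stirlingSeq, div_le_iff₀ (by positivity)] at h
  refine h.trans (le_of_eq ?_)
  rw [Real.sqrt_mul (by norm_num)]
  have : √(2 : ℝ) ≠ 0 := by positivity
  field_simp

theorem Real.Gamma_le_stirling {x : ℝ} (hx : 1 ≤ x) :
    Real.Gamma x ≤ Real.exp 2 * (x ^ (x - 1 / 2) * Real.exp (-x)) := by
  set n := ⌊x⌋₊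
  have hn1 : 1 ≤ n := Nat.le_floor (by simpa using hx)
  have hn0 : (0 : ℝ) < n := by exact_mod_cast hn1
  have hle : (n : ℝ) ≤ x := Nat.floor_le (by linarith)
  have hlt : x < n + 1 := Nat.lt_floor_add_one x
  have hG : Real.Gamma n = n.factorial / n := by
    rw [← Real.Gamma_nat_eq_factorial, Real.Gamma_add_one hn0.ne']
    field_simp
  have h1 : Real.Gamma x ≤ Real.Gamma n * (n : ℝ) ^ (x - n) := by
    rcases hle.eq_or_lt with h | h
    · simp [← h]
    · have := Real.Gamma_mul_add_mul_le_rpow_Gamma_mul_rpow_Gamma hn0 (by linarith : 0 < (n : ℝ) + 1)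
        (by linarith : 0 < 1 - (x - n)) (by linarith : 0 < x - n) (by ring)
      have hp := Real.Gamma_pos_of_pos hn0
      rw [Real.Gamma_add_one hn0.ne', Real.mul_rpow hn0.le hp.le, mul_left_comm,
        ← Real.rpow_add hp] at this
      convert this using 1
      · congr 1; ring
      · simp [mul_comm]
  calc Real.Gamma x ≤ (Real.exp 1 * √n * (n / Real.exp 1) ^ n) / n * (n : ℝ) ^ (x - n) := by
        refine h1.trans ?_
        rw [hG]
        gcongr
        exact Real.factorial_le_stirling (by omega)
    _ = Real.exp (1 - n) * (n : ℝ) ^ (x - 1 / 2) := by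
        rw [div_pow, ← Real.exp_nat_mul, mul_one, Real.exp_sub, Real.sqrt_eq_rpow,
          show x - 1 / 2 = 1 / 2 + n - 1 + (x - n) by ring, Real.rpow_add hn0 _ (x - n),
          Real.rpow_sub hn0 (1 / 2 + n) 1, Real.rpow_add hn0, Real.rpow_one, Real.rpow_natCast]
        field_simp
    _ ≤ Real.exp (2 - x) * x ^ (x - 1 / 2) := by
        have := Real.rpow_le_rpow hn0.le hle (by linarith : 0 ≤ x - 1 / 2)
        exact mul_le_mul (Real.exp_le_exp.mpr (by linarith)) this (by positivity) (by positivity)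
    _ = _ := by rw [sub_eq_add_neg, Real.exp_add]; ring

theorem Real.exists_Gamma_add_le (b : ℝ) (hb : 0 < b) :
    ∃ K > 0, ∀ y : ℝ, 1 ≤ y →
      Real.Gamma (y + b) ≤ K * (y ^ (y + b - 1 / 2) * Real.exp (-y)) := by
  refine ⟨Real.exp 2 * (1 + b) ^ b, by positivity, fun y hy => ?_⟩
  have hy0 : 0 < y := by linarith
  have hby : 0 < b / y := by positivity
  have h1 : y + b = y * (1 + b / y) := by field_simp
  have h2 : (y + b) ^ (y + b - 1 / 2) ≤
      y ^ (y + b - 1 / 2) * (Real.exp b * (1 + b) ^ b) := by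
    nth_rw 1 [h1]
    rw [Real.mul_rpow hy0.le (by positivity)]
    gcongr
    calc (1 + b / y) ^ (y + b - 1 / 2) ≤ (1 + b / y) ^ (y + b) := by
          apply Real.rpow_le_rpow_of_exponent_le <;> linarith
      _ = (1 + b / y) ^ y * (1 + b / y) ^ b := Real.rpow_add (by positivity) _ _
      _ ≤ _ := by
          gcongr
          · calc (1 + b / y) ^ y ≤ (Real.exp (b / y)) ^ y := by
                  gcongr
                  linarith [Real.add_one_le_exp (b / y)]
              _ = Real.exp b := by rw [← Real.exp_mul]; congr 1; field_simp
          · exact div_le_self hb.le hy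
  refine (Real.Gamma_le_stirling (by linarith)).trans ?_
  calc _ ≤ Real.exp 2 * (y ^ (y + b - 1 / 2) * (Real.exp b * (1 + b) ^ b) * Real.exp (-(y + b))) := by
        gcongr
    _ = _ := by
        rw [neg_add, Real.exp_add, Real.exp_neg b]
        field_simp

theorem integrable_inv_one_add_affine_sq {a : ℝ} (ha : a ≠ 0) (b : ℝ) :
    Integrable fun t : ℝ => (1 + (a * t + b) ^ 2)⁻¹ :=
  (integrable_inv_one_add_sq.comp_add_right b).comp_mul_left' ha

theorem integral_inv_one_add_affine_sq (a b : ℝ) :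
    ∫ t : ℝ, (1 + (a * t + b) ^ 2)⁻¹ = |a⁻¹| * Real.pi := by
  rw [Measure.integral_comp_mul_left (fun u : ℝ => (1 + (u + b) ^ 2)⁻¹) a,
    integral_add_right_eq_self (fun u : ℝ => (1 + u ^ 2)⁻¹) b, integral_univ_inv_one_add_sq,
    smul_eq_mul]

theorem norm_VI_le {q : ℕ} {α : Fin q → ℝ} (hα : ∀ i, 0 < α i) {B : Fin q → ℂ}
    (hB : ∀ i, 0 < (B i).re) (j : Fin q) {c : ℝ} (hc : 0 < c) (hj : 1 ≤ α j * c + (B j).re)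
    {x : ℝ} (hx : 0 < x) :
    ‖VI α B c x‖ ≤ 5 / (2 * α j) * √(α j * c + (B j).re) *
      (∏ i, Real.Gamma (α i * c + (B i).re)) * x ^ (-c) := by
  set σ : Fin q → ℝ := fun i => α i * c + (B i).re with hσ
  have hσ0 : ∀ i, 0 < σ i := fun i => add_pos (mul_pos (hα i) hc) (hB i)
  have hr : 0 < √(σ j) := Real.sqrt_pos.mpr (hσ0 j)
  have hre : ∀ i (t : ℝ), ((α i : ℂ) * ((c : ℂ) + (t : ℂ) * I) + B i).re = σ i := fun i t => by
    simp [hσ]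
  have him : ∀ i (t : ℝ), ((α i : ℂ) * ((c : ℂ) + (t : ℂ) * I) + B i).im = α i * t + (B i).im :=
    fun i t => by simp
  have ha : α j / (5 * √(σ j)) ≠ 0 := (div_pos (hα j) (by positivity)).ne'
  have hbound : ∀ t : ℝ, ‖I * ((∏ i, Gamma ((α i : ℂ) * ((c : ℂ) + (t : ℂ) * I) + B i)) *
      (x : ℂ) ^ (-((c : ℂ) + (t : ℂ) * I)))‖ ≤ (∏ i, Real.Gamma (σ i)) * x ^ (-c) *
        (1 + (α j / (5 * √(σ j)) * t + (B j).im / (5 * √(σ j))) ^ 2)⁻¹ := fun t => by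
    rw [norm_mul, norm_I, one_mul, norm_mul, norm_cpow_eq_rpow_re_of_pos hx, norm_prod,
      ← mul_prod_erase univ _ (mem_univ j), ← mul_prod_erase univ (fun i => Real.Gamma (σ i))
      (mem_univ j)]
    have h1 := norm_Gamma_le_Gamma_re_mul_inv (s := (α j : ℂ) * ((c : ℂ) + (t : ℂ) * I) + B j)
      (by rw [hre]; exact hj)
    have h2 : ∏ i ∈ univ.erase j, ‖Gamma ((α i : ℂ) * ((c : ℂ) + (t : ℂ) * I) + B i)‖ ≤
        ∏ i ∈ univ.erase j, Real.Gamma (σ i) :=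
      prod_le_prod (fun _ _ => norm_nonneg _) fun i _ =>
        (norm_Gamma_le_Gamma_re (by rw [hre]; exact hσ0 i)).trans_eq (by rw [hre])
    rw [hre, him] at h1
    have e1 : (-((c : ℂ) + (t : ℂ) * I)).re = -c := by simp
    rw [e1, ← mul_div_right_comm, ← add_div]
    have hG := (Real.Gamma_pos_of_pos (hσ0 j)).le
    calc _ ≤ (Real.Gamma (σ j) * (1 + ((α j * t + (B j).im) / (5 * √(σ j))) ^ 2)⁻¹ *
          ∏ i ∈ univ.erase j, Real.Gamma (σ i)) * x ^ (-c) := by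
          gcongr
      _ = _ := by ring
  have h := norm_integral_le_of_norm_le
    ((integrable_inv_one_add_affine_sq ha ((B j).im / (5 * √(σ j)))).const_mul
      ((∏ i, Real.Gamma (σ i)) * x ^ (-c))) (Eventually.of_forall hbound)
  rw [integral_const_mul ((∏ i, Real.Gamma (σ i)) * x ^ (-c)), integral_inv_one_add_affine_sq,
    inv_div, abs_of_pos (div_pos (by positivity) (hα j))] at h
  have e2 : ‖(2 * (Real.pi : ℂ) * I)⁻¹‖ = (2 * Real.pi)⁻¹ := by
    simp [abs_of_pos Real.pi_pos]
  rw [VI, norm_mul, e2]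
  refine (mul_le_mul_of_nonneg_left h (by positivity)).trans_eq ?_
  have := (hα j).ne'
  have := Real.pi_pos.ne'
  change _ = 5 / (2 * α j) * √(σ j) * (∏ i, Real.Gamma (σ i)) * x ^ (-c)
  field_simp

theorem exists_prod_Gamma_le {q : ℕ} {α : Fin q → ℝ} (hα : ∀ i, 0 < α i) {b : Fin q → ℝ}
    (hb : ∀ i, 0 < b i) :
    ∃ K > 0, ∀ d > 0, (∀ i, 1 ≤ α i * d) →
      ∏ i, Real.Gamma (α i * d + b i) ≤ K * ((∏ i, α i ^ α i) ^ d * d ^ ((∑ i, α i) * d) *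
        d ^ (∑ i, b i - q / 2) * Real.exp (-((∑ i, α i) * d))) := by
  choose K hK0 hK using fun i => Real.exists_Gamma_add_le (b i) (hb i)
  refine ⟨∏ i, (K i * α i ^ (b i - 1 / 2)),
    prod_pos fun i _ => mul_pos (hK0 i) (Real.rpow_pos_of_pos (hα i) _), fun d hd h1 => ?_⟩
  calc ∏ i, Real.Gamma (α i * d + b i)
      ≤ ∏ i, (K i * α i ^ (b i - 1 / 2)) * ((α i ^ α i) ^ d * d ^ (α i * d) *
        d ^ (b i - 1 / 2) * Real.exp (-(α i * d))) := by
        refine prod_le_prod (fun i _ => Real.Gamma_nonneg_of_nonneg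
          (add_pos (mul_pos (hα i) hd) (hb i)).le) fun i _ => (hK i _ (h1 i)).trans_eq ?_
        rw [Real.mul_rpow (hα i).le hd.le, add_sub_assoc, Real.rpow_add (hα i),
          Real.rpow_add hd, Real.rpow_mul (hα i).le]
        ring
    _ = _ := by
        simp only [prod_mul_distrib]
        rw [← Real.exp_sum, ← Real.rpow_sum_of_pos hd, ← Real.rpow_sum_of_pos hd,
          Real.finsetProd_rpow _ _ fun i _ => Real.rpow_nonneg (hα i).le _, sum_neg_distrib,
          ← sum_mul, sum_sub_distrib]
        simp [div_eq_mul_inv]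

theorem exists_norm_VI_le {q : ℕ} (hq : 1 ≤ q) {α : Fin q → ℝ} (hα : ∀ i, 0 < α i)
    {B : Fin q → ℂ} (hB : ∀ i, 0 < (B i).re) :
    ∃ C D : ℝ, 0 < C ∧ 0 < D ∧ ∀ d ≥ D,
      ‖VI α B d ((∏ i, α i ^ α i) * d ^ (∑ i, α i))‖ ≤
        C * Real.exp (-((∑ i, α i) * d)) * d ^ (∑ i, (B i).re + (1 - q) / 2) := by
  obtain ⟨K, hK0, hK⟩ := exists_prod_Gamma_le hα hB
  let j : Fin q := ⟨0, hq⟩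
  have hαj := hα j
  have hBj := hB j
  refine ⟨5 / (2 * α j) * √(α j + (B j).re) * K, 1 + ∑ i, (α i)⁻¹, by positivity,
    add_pos_of_pos_of_nonneg one_pos (sum_nonneg fun i _ => (inv_pos.mpr (hα i)).le),
    fun d hd => ?_⟩
  have hd1 : 1 ≤ d :=
    le_trans (le_add_of_nonneg_right (sum_nonneg fun i _ => (inv_pos.mpr (hα i)).le)) hd
  have hd0 : 0 < d := by linarith
  have h1 : ∀ i, 1 ≤ α i * d := fun i => by
    have h2 : (α i)⁻¹ ≤ ∑ i, (α i)⁻¹ :=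
      single_le_sum (f := fun i => (α i)⁻¹) (fun i _ => (inv_pos.mpr (hα i)).le) (mem_univ i)
    rw [← inv_le_iff_one_le_mul₀' (hα i)]
    linarith
  have hP : 0 < ∏ i, α i ^ α i := prod_pos fun i _ => Real.rpow_pos_of_pos (hα i) _
  have hA := Real.rpow_pos_of_pos hd0 (∑ i, α i)
  refine (norm_VI_le hα hB j hd0 (by linarith [h1 j]) (mul_pos hP hA)).trans ?_
  have hs : √(α j * d + (B j).re) ≤ √(α j + (B j).re) * d ^ (1 / 2 : ℝ) := by
    rw [← Real.sqrt_eq_rpow, ← Real.sqrt_mul (by positivity)]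
    apply Real.sqrt_le_sqrt
    nlinarith
  have hpow : ((∏ i, α i ^ α i) * d ^ (∑ i, α i)) ^ (-d) =
      ((∏ i, α i ^ α i) ^ d * d ^ ((∑ i, α i) * d))⁻¹ := by
    rw [Real.rpow_neg (by positivity), Real.mul_rpow hP.le hA.le, Real.rpow_mul hd0.le]
  calc _ ≤ 5 / (2 * α j) * (√(α j + (B j).re) * d ^ (1 / 2 : ℝ)) *
        (K * ((∏ i, α i ^ α i) ^ d * d ^ ((∑ i, α i) * d) *
        d ^ (∑ i, (B i).re - q / 2) * Real.exp (-((∑ i, α i) * d)))) *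
        ((∏ i, α i ^ α i) * d ^ (∑ i, α i)) ^ (-d) := by
        gcongr
        · exact prod_nonneg fun i _ => Real.Gamma_nonneg_of_nonneg
            (add_pos (mul_pos (hα i) hd0) (hB i)).le
        · exact hK d hd0 h1
    _ = _ := by
        rw [hpow,
          show ∑ i, (B i).re + (1 - (q : ℝ)) / 2 = 1 / 2 + (∑ i, (B i).re - q / 2) by ring,
          Real.rpow_add hd0]
        field_simp

/-- Exponential decay of `Z̃_{α,β}(x)` as `x → ∞`, for rational `αᵢ > 0` and `Re βᵢ > 0`. -/
theorem statement13 (q : ℕ) (hq : 1 ≤ q) (α : Fin q → ℚ) (hα : ∀ i, 0 < α i)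
    (β : Fin q → ℂ) (hβ : ∀ i, 0 < (β i).re)
    (L : ℕ) (hL : L = (Finset.univ : Finset (Fin q)).lcm fun i => (α i).den)
    (k : Fin q → ℕ) (hk : ∀ i, (k i : ℚ) = α i * L)
    (dF : ℝ) (hdF : dF = 2 * ∑ i, (α i : ℝ))
    (C₁ C₂ : ℝ) (C₃ : ℂ)
    (hC₁ : C₁ = (L : ℝ) * dF /
      (2 * (∏ i, (k i : ℝ) ^ (k i)) ^ (2 / ((L : ℝ) * dF))))
    (hC₂ : C₂ = 2 / dF)
    (hC₃ : C₃ = (∑ i, (starRingEnd ℂ) (β i)) + (1 - (q : ℂ)) / 2)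
    (Zt : ℝ → ℂ)
    (hZt : ∀ d : ℝ, 0 < d → ∀ x : ℝ, 0 < x →
      Zt x = VI (fun i => (α i : ℝ)) (fun i => (starRingEnd ℂ) (β i)) d x) :
    ∃ C x₀ : ℝ, 0 < C ∧ 0 < x₀ ∧ ∀ x : ℝ, x₀ ≤ x →
      ‖Zt x‖ ≤ C * Real.exp (-C₁ * x ^ C₂) * x ^ (C₂ * C₃.re) := by
  have ha : ∀ i, (0 : ℝ) < α i := fun i => by exact_mod_cast hα i
  obtain ⟨C, D, hC, hD, hbound⟩ := exists_norm_VI_le hq ha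
    (B := fun i => (starRingEnd ℂ) (β i)) (by simpa using hβ)
  set A : ℝ := ∑ i, (α i : ℝ) with hAdef
  set P : ℝ := ∏ i, (α i : ℝ) ^ (α i : ℝ) with hPdef
  have hA : 0 < A := sum_pos (fun i _ => ha i) ⟨⟨0, hq⟩, mem_univ _⟩
  have hP : 0 < P := prod_pos fun i _ => Real.rpow_pos_of_pos (ha i) _
  have hL0 : (0 : ℝ) < L := by
    have : L ≠ 0 := by
      rw [hL, Ne, Finset.lcm_eq_zero_iff]
      simp
    exact_mod_cast Nat.pos_of_ne_zero this
  have hk' : ∀ i, (k i : ℝ) = α i * L := fun i => by exact_mod_cast hk i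
  have hC₂A : C₂ = A⁻¹ := by
    rw [hC₂, hdF]
    field_simp
  have hprod : (∏ i, (k i : ℝ) ^ (k i)) = (L : ℝ) ^ (L * A) * P ^ (L : ℝ) := by
    rw [hAdef, hPdef, mul_sum, Real.rpow_sum_of_pos hL0,
      ← Real.finsetProd_rpow _ _ fun i _ => Real.rpow_nonneg (ha i).le _, ← prod_mul_distrib]
    refine prod_congr rfl fun i _ => ?_
    rw [← Real.rpow_natCast, hk', Real.mul_rpow (ha i).le hL0.le, ← Real.rpow_mul (ha i).le,
      mul_comm (α i : ℝ) L, mul_comm]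
  have hC₁A : C₁ = A * (P ^ A⁻¹)⁻¹ := by
    have e : 2 / ((L : ℝ) * dF) = (L * A)⁻¹ := by
      rw [hdF]
      field_simp
    rw [hC₁, e, hprod, Real.mul_rpow (by positivity) (by positivity),
      Real.rpow_rpow_inv hL0.le (by positivity), ← Real.rpow_mul hP.le,
      show (L : ℝ) * (L * A)⁻¹ = A⁻¹ by field_simp, hdF]
    field_simp
  have hC₃A : C₃.re = ∑ i, ((starRingEnd ℂ) (β i)).re + (1 - (q : ℝ)) / 2 := by
    rw [hC₃, add_re, re_sum, div_ofNat_re]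
    simp
  rw [← hC₃A] at hbound
  have hQ : 0 < (P⁻¹ ^ A⁻¹) ^ C₃.re := by positivity
  refine ⟨C * (P⁻¹ ^ A⁻¹) ^ C₃.re, P * D ^ A, by positivity, by positivity, fun x hx => ?_⟩
  have hx0 : 0 < x := lt_of_lt_of_le (by positivity) hx
  have hd : D ≤ (P⁻¹ * x) ^ A⁻¹ := by
    rw [Real.le_rpow_inv_iff_of_pos hD.le (by positivity) hA, le_inv_mul_iff₀ hP]
    exact hx
  have hxd : P * ((P⁻¹ * x) ^ A⁻¹) ^ A = x := by
    rw [Real.rpow_inv_rpow (by positivity) hA.ne']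
    field_simp
  have h := hbound _ hd
  rw [hxd, ← hZt _ (hD.trans_le hd) x hx0, Real.mul_rpow (by positivity) hx0.le,
    Real.mul_rpow (by positivity) (by positivity), ← Real.rpow_mul hx0.le, ← hC₂A] at h
  refine h.trans_eq ?_
  rw [hC₁A, ← hC₂A, Real.inv_rpow hP.le,
    show A * ((P ^ C₂)⁻¹ * x ^ C₂) = A * (P ^ C₂)⁻¹ * x ^ C₂ by ring, neg_mul]
  ring

end
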